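/- Let n ≥ 1. For every k ≥ 0, the operator Jq^k, regarded as a ℤ₂-linear endomorphism of ℤ₂[ξ₁,…,ξₙ], belongs to the ℤ₂-subalgebra of the algebra of ℤ₂-linear endomorphisms of ℤ₂[ξ₁,…,ξₙ] generated by the operators {Jq^{2^i} : i ≥ 0}. -/

import Mathlib

open MvPolynomial

/-- Total dyadic Steenrod square with a formal variable `t` recording the degree shift:
`ξᵢ ↦ ξᵢ + ξᵢ²·t`.  For a homogeneous `f` of degree `d`, the coefficient of `t^k`
is exactly the homogeneous component of degree `d + k` of the image of `f` under the
algebra endomorphism `ξᵢ ↦ ξᵢ + ξᵢ²`. -/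
noncomputable def JqT (R : Type) [CommRing R] (n : ℕ) :
    MvPolynomial (Fin n) R →ₐ[R] Polynomial (MvPolynomial (Fin n) R) :=
  aeval fun i : Fin n => Polynomial.C (X i) + Polynomial.C (X i ^ 2) * Polynomial.X

/-- The `k`-th (dyadic, for `R = ℤ_[2]`) Steenrod square `Jq^k`, as an `R`-linear
endomorphism of `R[ξ₁,…,ξₙ]`: it sends a homogeneous polynomial of degree `d` to the
homogeneous component of degree `d + k` of its image under the algebra endomorphism
`ξᵢ ↦ ξᵢ + ξᵢ²`. -/
noncomputable def Jq (R : Type) [CommRing R] (n : ℕ) (k : ℕ) :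
    MvPolynomial (Fin n) R →ₗ[R] MvPolynomial (Fin n) R :=
  (LinearMap.restrictScalars R (Polynomial.lcoeff (MvPolynomial (Fin n) R) k)).comp
    (JqT R n).toLinearMap

/-! ### Exponential Bell polynomials and composition of exponential power series -/

/-- Partial exponential Bell polynomials: `F ^ l / l! = ∑ bell a l m u ^ m / m!`
where `F = ∑ a m u ^ m / m!`. -/
def bell {R : Type} [CommRing R] (a : ℕ → R) : ℕ → ℕ → R
  | 0, 0 => 1
  | 0, _ + 1 => 0
  | _ + 1, 0 => 0
  | l + 1, m + 1 => ∑ j ∈ Finset.range (m + 1), (m.choose j : R) * bell a l j * a (m - j + 1)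

/-- The exponential sequence `0, 1, x 0, x 1, …`. -/
def hz {R : Type} [CommRing R] (x : ℕ → R) : ℕ → R
  | 0 => 0
  | 1 => 1
  | m + 2 => x m

/-- Coefficients of the composite of exponential series. -/
def hcomp {R : Type} [CommRing R] (a b : ℕ → R) (m : ℕ) : R :=
  ∑ l ∈ Finset.range (m + 1), a l * bell b l m

/-- The composition group law in exponential coordinates. -/
def gstar {R : Type} [CommRing R] (x y : ℕ → R) (m : ℕ) : R := hcomp (hz x) (hz y) (m + 2)

section bell
variable {R : Type} [CommRing R] {R' : Type} [CommRing R']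

theorem bell_succ_succ (a : ℕ → R) (l m : ℕ) : bell a (l + 1) (m + 1) =
    ∑ j ∈ Finset.range (m + 1), (m.choose j : R) * bell a l j * a (m - j + 1) := by
  rw [bell]

theorem bell_zero_zero (a : ℕ → R) : bell a 0 0 = 1 := by rw [bell]
theorem bell_zero_succ (a : ℕ → R) (m : ℕ) : bell a 0 (m + 1) = 0 := by rw [bell]
theorem bell_succ_zero (a : ℕ → R) (m : ℕ) : bell a (m + 1) 0 = 0 := by rw [bell]

theorem bell_lt (a : ℕ → R) : ∀ l m, m < l → bell a l m = 0
  | 0, m, h => by omega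
  | l + 1, 0, _ => bell_succ_zero a l
  | l + 1, m + 1, h => by
    rw [bell_succ_succ]
    refine Finset.sum_eq_zero fun j hj => ?_
    rw [bell_lt a l j (by simp at hj; omega)]; simp

theorem bell_one (a : ℕ → R) (m : ℕ) : bell a 1 (m + 1) = a (m + 1) := by
  rw [bell_succ_succ, Finset.sum_range_succ']
  simp [bell_zero_zero, bell_zero_succ]

theorem bell_map (g : R →+* R') (a : ℕ → R) : ∀ l m, g (bell a l m) = bell (fun i => g (a i)) l m
  | 0, 0 => by simp [bell_zero_zero]
  | 0, m + 1 => by simp [bell_zero_succ]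
  | l + 1, 0 => by simp [bell_succ_zero]
  | l + 1, m + 1 => by
    rw [bell_succ_succ, bell_succ_succ, map_sum]
    refine Finset.sum_congr rfl fun j _ => ?_
    simp [bell_map g a l j]

theorem bell_congr {a b : ℕ → R} : ∀ l m, (∀ i ≤ m, a i = b i) → bell a l m = bell b l m
  | 0, 0, _ => by simp [bell_zero_zero]
  | 0, m + 1, _ => by simp [bell_zero_succ]
  | l + 1, 0, _ => by simp [bell_succ_zero]
  | l + 1, m + 1, h => by
    rw [bell_succ_succ, bell_succ_succ]
    refine Finset.sum_congr rfl fun j hj => ?_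
    simp only [Finset.mem_range] at hj
    rw [bell_congr l j (fun i hi => h i (by omega)), h _ (by omega)]

theorem hz_map (g : R →+* R') (x : ℕ → R) (m : ℕ) : g (hz x m) = hz (fun i => g (x i)) m := by
  match m with
  | 0 => simp [hz]
  | 1 => simp [hz]
  | m + 2 => simp [hz]

theorem gstar_map (g : R →+* R') (x y : ℕ → R) (m : ℕ) :
    g (gstar x y m) = gstar (fun i => g (x i)) (fun i => g (y i)) m := by
  simp only [gstar, hcomp, map_sum, map_mul, bell_map, hz_map]

theorem hz_gstar (x y : ℕ → R) (m : ℕ) : hz (gstar x y) m = hcomp (hz x) (hz y) m := by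
  match m with
  | 0 => simp [hz, hcomp]
  | 1 => simp [hz, hcomp, Finset.sum_range_succ, bell_one (hz y) 0]
  | m + 2 => simp [hz, gstar]

theorem hz_congr {x y : ℕ → R} {m : ℕ} (h : ∀ i, i + 2 ≤ m → x i = y i) : hz x m = hz y m := by
  match m with
  | 0 => rfl
  | 1 => rfl
  | m + 2 => exact h m le_rfl

theorem gstar_congr {x x' y y' : ℕ → R} {m : ℕ} (hx : ∀ i ≤ m, x i = x' i)
    (hy : ∀ i ≤ m, y i = y' i) : gstar x y m = gstar x' y' m := by
  unfold gstar hcomp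
  refine Finset.sum_congr rfl fun l hl => ?_
  simp only [Finset.mem_range] at hl
  rw [hz_congr (x := x) (y := x') fun i hi => hx i (by omega),
    bell_congr (b := hz y') l _ fun i hi => hz_congr fun j hj => hy j (by omega)]

/-- infinitesimal case -/
theorem bell_inf (m : ℕ) (e : R) (he : e * e = 0) : ∀ l n,
    bell (hz (Pi.single m e)) l n = (if n = l then 1 else 0) +
      if n = l + (m + 1) then e * (n.choose (m + 2) : R) else 0
  | 0, 0 => by simp [bell_zero_zero]
  | 0, n + 1 => by
    rw [bell_zero_succ]
    by_cases h : n = m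
    · subst h; simp
    · simp [h]
  | l + 1, 0 => by simp [bell_succ_zero]
  | l + 1, n + 1 => by
    rw [bell_succ_succ, Finset.sum_range_succ]
    have h1 : ∑ j ∈ Finset.range n, (n.choose j : R) * bell (hz (Pi.single m e)) l j *
        hz (Pi.single m e) (n - j + 1) = if n = l + (m + 1) then e * (n.choose (m + 1) : R) else 0 := by
      have h2 : ∀ j ∈ Finset.range n, (n.choose j : R) * bell (hz (Pi.single m e)) l j *
        hz (Pi.single m e) (n - j + 1) = if j + (m + 1) = n then
          (if n = l + (m + 1) then e * (n.choose (m + 1) : R) else 0) else 0 := by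
        intro j hj
        simp only [Finset.mem_range] at hj
        obtain ⟨d, rfl⟩ : ∃ d, n = j + d + 1 := ⟨n - j - 1, by omega⟩
        have : j + d + 1 - j + 1 = d + 2 := by omega
        rw [this, bell_inf m e he l j]
        simp only [hz, Pi.single_apply]
        by_cases hd : d = m
        · subst hd
          have hc : (j + d + 1).choose j = (j + d + 1).choose (d + 1) := by
            rw [add_assoc]
            exact Nat.choose_symm_add
          by_cases hl : j = l
          · subst hl
            rw [hc]; simp [add_assoc, mul_comm]
          · have h3 : ¬ (j + d + 1 = l + (d + 1)) := by omega
            simp only [hl, h3, if_false, if_true, zero_add]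
            split_ifs <;> first
              | omega
              | linear_combination (((j + d + 1).choose j : R) * (j.choose (d+2) : R)) * he
              | ring
        · have h3 : ¬ (j + (m + 1) = j + d + 1) := by omega
          simp [hd, h3]
      rw [Finset.sum_congr rfl h2]
      by_cases hn : n = l + (m + 1)
      · subst hn
        simp
      · simp [hn]
    rw [h1, bell_inf m e he l n]
    simp only [hz, Nat.choose_self, Nat.cast_one, Nat.sub_self, zero_add, mul_one, one_mul,
      Nat.succ_inj]
    by_cases hn : n = l + (m + 1)
    · subst hn
      have : l + (m + 1) + 1 = l + 1 + (m + 1) := by omega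
      simp only [if_true, this]
      rw [← this, Nat.choose_succ_succ' (l + (m + 1)) (m + 1)]
      push_cast
      ring
    · have : ¬ (n + 1 = l + 1 + (m + 1)) := by omega
      simp [hn, this]

theorem bell_id (l n : ℕ) :
    bell (hz (0 : ℕ → R)) l n = (if n = l then 1 else 0) := by
  have := bell_inf (R := R) 0 0 (by simp) l n
  simpa using this

theorem gstar_zero_right (x : ℕ → R) : gstar x 0 = x := by
  ext m
  simp [gstar, hcomp, bell_id, hz]

theorem gstar_zero_left (x : ℕ → R) : gstar 0 x = x := by
  ext m
  unfold gstar hcomp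
  rw [Finset.sum_eq_single 1]
  · simp [bell_one (hz x) (m + 1), hz]
  · intro b _ hb
    match b with
    | 0 => simp [hz]
    | 1 => simp at hb
    | b + 2 => simp [hz]
  · simp

theorem gstar_inf (x : ℕ → R) (m : ℕ) (e : R) (he : e * e = 0) (n : ℕ) :
    gstar x (Pi.single m e) n = x n + e * (((n + 2).choose (m + 2) : R) * hz x (n + 1 - m)) := by
  unfold gstar hcomp
  simp only [bell_inf m e he, mul_add, Finset.sum_add_distrib]
  congr 1
  · simp [hz]
  · by_cases h : m ≤ n
    · rw [Finset.sum_eq_single (n + 1 - m)]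
      · rw [if_pos (by omega)]; ring
      · intro b _ hb
        rw [if_neg (by omega)]; simp
      · intro hb; simp at hb; omega
    · rw [Nat.choose_eq_zero_of_lt (by omega)]
      simp

/-- the value at `u + u ^ 2 / 2`. -/
theorem bell_f_rec (l n : ℕ) : bell (hz (Pi.single 0 (1 : R))) (l + 1) (n + 2) =
    bell (hz (Pi.single 0 (1 : R))) l (n + 1) + (n + 1 : R) * bell (hz (Pi.single 0 (1 : R))) l n := by
  rw [bell_succ_succ, Finset.sum_range_succ, Finset.sum_range_succ, Finset.sum_eq_zero]
  · have : n + 1 - n + 1 = 2 := by omega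
    simp [this, hz, Nat.choose_succ_self_right]
    ring
  · intro j hj
    simp only [Finset.mem_range] at hj
    obtain ⟨d, rfl⟩ : ∃ d, n = j + d + 1 := ⟨n - j - 1, by omega⟩
    have : j + d + 1 + 1 - j + 1 = (d + 1) + 2 := by omega
    rw [this]; simp [hz]

theorem bell_f_gt : ∀ l n, 2 * l < n → bell (hz (Pi.single 0 (1 : R))) l n = 0
  | 0, n + 1, _ => bell_zero_succ _ _
  | l + 1, n + 2, h => by
    rw [bell_f_rec, bell_f_gt l _ (by omega), bell_f_gt l _ (by omega)]; simp

theorem bell_f_eq [CharP R 2] : ∀ l, bell (hz (Pi.single 0 (1 : R))) l (2 * l) = 1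
  | 0 => bell_zero_zero _
  | l + 1 => by
    rw [show 2 * (l + 1) = 2 * l + 2 by ring, bell_f_rec, bell_f_gt _ _ (by omega), bell_f_eq l]
    have : (2 : R) = 0 := CharTwo.two_eq_zero
    push_cast
    rw [this]; simp

end bell

/-! ### Primitive polynomials over the field with two elements -/

/-- Weight of a monomial, where the `i`-th variable has weight `i + 1`. -/
noncomputable def wt : (ℕ →₀ ℕ) →+ ℕ := Finsupp.weight (fun i : ℕ => i + 1)

theorem wt_single (i e : ℕ) : wt (Finsupp.single i e) = e * (i + 1) := by
  simp [wt, Finsupp.weight_single]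

theorem le_wt_index {κ : ℕ →₀ ℕ} {i : ℕ} (h : κ i ≠ 0) : i + 1 ≤ wt κ :=
  Finsupp.le_weight_of_ne_zero' (fun i : ℕ => i + 1) h

theorem le_wt (κ : ℕ →₀ ℕ) (i : ℕ) : κ i ≤ wt κ :=
  Finsupp.le_weight (fun i : ℕ => i + 1) (by simp) κ

theorem wt_eq_zero {κ : ℕ →₀ ℕ} (h : wt κ = 0) : κ = 0 := by
  ext i
  have := le_wt κ i
  simp; omega

theorem wt_finite (k : ℕ) : {κ : ℕ →₀ ℕ | wt κ = k}.Finite := by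
  refine Set.Finite.subset (Finset.finite_toSet
    (Finset.finsupp (Finset.range k) (fun _ => Finset.range (k + 1)))) ?_
  intro κ hκ
  simp only [Set.mem_ofPred_eq] at hκ
  simp only [Finset.mem_coe, Finset.mem_finsupp_iff]
  refine ⟨fun i hi => ?_, fun i _ => ?_⟩
  · have := le_wt_index (Finsupp.mem_support_iff.1 hi)
    simp; omega
  · have := le_wt κ i
    simp; omega

/-- The identity expressing primitivity. -/
def Prim (φ : MvPolynomial ℕ (ZMod 2)) : Prop :=
  aeval (gstar (fun m => (X m : MvPolynomial ℕ (MvPolynomial ℕ (ZMod 2)))) (fun m => C (X m))) φ =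
    aeval (fun m => (X m : MvPolynomial ℕ (MvPolynomial ℕ (ZMod 2)))) φ + aeval (fun m => C (X m)) φ

theorem Prim.all {φ : MvPolynomial ℕ (ZMod 2)} (h : Prim φ) {R : Type} [CommRing R]
    [Algebra (ZMod 2) R] (x y : ℕ → R) :
    aeval (gstar x y) φ = aeval x φ + aeval y φ := by
  let g : MvPolynomial ℕ (MvPolynomial ℕ (ZMod 2)) →+* R :=
    eval₂Hom (aeval y : MvPolynomial ℕ (ZMod 2) →ₐ[ZMod 2] R).toRingHom x
  have hg : ∀ z : ℕ → MvPolynomial ℕ (MvPolynomial ℕ (ZMod 2)),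
      g (aeval z φ) = aeval (fun m => g (z m)) φ := by
    intro z
    have : g.comp (aeval z : MvPolynomial ℕ (ZMod 2) →ₐ[ZMod 2] _).toRingHom =
        (aeval (fun m => g (z m)) : MvPolynomial ℕ (ZMod 2) →ₐ[ZMod 2] R).toRingHom := by
      apply MvPolynomial.ringHom_ext
      · intro r
        exact RingHom.congr_fun (Subsingleton.elim
          ((g.comp (aeval z : MvPolynomial ℕ (ZMod 2) →ₐ[ZMod 2] _).toRingHom).comp C)
          ((aeval (fun m => g (z m)) : MvPolynomial ℕ (ZMod 2) →ₐ[ZMod 2] R).toRingHom.comp C)) r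
      · intro i; simp
    exact RingHom.congr_fun this φ
  have h2 := congrArg g h
  rw [map_add, hg, hg, hg] at h2
  simp only [gstar_map] at h2
  simpa [g] using h2

/-- first order Taylor expansion -/
theorem taylor {R : Type} [CommRing R] [Algebra (ZMod 2) R] (φ : MvPolynomial ℕ (ZMod 2)) (M : ℕ)
    (hM : ∀ i ∈ φ.vars, i < M) (x w : ℕ → R) (e : R) (he : e * e = 0) :
    aeval (fun n => x n + e * w n) φ =
      aeval x φ + e * ∑ n ∈ Finset.range M, w n * aeval x (pderiv n φ) := by
  have h1 : aeval (fun n => x n + e * w n) φ = aeval (fun n => x n + e * if n < M then w n else 0) φ := by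
    refine eval₂Hom_congr' rfl ?_ rfl
    intro i hi _
    simp [hM i hi]
  rw [h1]
  clear h1 hM
  induction φ using MvPolynomial.induction_on with
  | C a => simp
  | add p q hp hq =>
    simp only [map_add, hp, hq, mul_add, Finset.sum_add_distrib]
    ring
  | mul_X p i hp =>
    simp only [map_mul, hp, aeval_X, Derivation.leibniz, smul_eq_mul, map_add, pderiv_X, mul_add,
      Finset.sum_add_distrib, Pi.single_apply]
    have h3 : ∑ n ∈ Finset.range M, w n * (aeval x p * aeval x (if i = n then (1 : MvPolynomial ℕ (ZMod 2)) else 0)) =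
      (aeval x p) * if i < M then w i else 0 := by
      have : ∀ n ∈ Finset.range M, w n * (aeval x p * aeval x (if i = n then (1 : MvPolynomial ℕ (ZMod 2)) else 0)) =
          if i = n then aeval x p * w i else 0 := by
        intro n _
        split_ifs with h
        · subst h; simp; ring
        · simp
      rw [Finset.sum_congr rfl this, Finset.sum_ite_eq]
      simp
    have h4 : ∑ n ∈ Finset.range M, w n * (x i * aeval x (pderiv n p)) =
      x i * ∑ n ∈ Finset.range M, w n * aeval x (pderiv n p) := by
      rw [Finset.mul_sum]
      refine Finset.sum_congr rfl fun n _ => by ring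
    rw [h3, h4]
    linear_combination ((∑ n ∈ Finset.range M, w n * aeval x (pderiv n p)) *
      if i < M then w i else 0) * he

/-- homogeneity of weight `k` -/
def Hom (φ : MvPolynomial ℕ (ZMod 2)) (k : ℕ) : Prop := ∀ κ, coeff κ φ ≠ 0 → wt κ = k

section prim
variable {φ : MvPolynomial ℕ (ZMod 2)} {k : ℕ}

theorem Hom.vars (hφ : Hom φ k) : ∀ i ∈ φ.vars, i < k := by
  intro i hi
  rw [mem_vars_iff_mem_support] at hi
  obtain ⟨d, hd, hi⟩ := hi
  have := hφ d (mem_support_iff.1 hd)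
  have := le_wt_index (Finsupp.mem_support_iff.1 hi)
  omega

theorem Hom.pderiv_const (hφ : Hom φ k) {m : ℕ} (hm : m + 1 ≠ k) :
    constantCoeff (pderiv m φ) = 0 := by
  rw [constantCoeff_eq, coeff_pderiv]
  have : coeff (0 + Finsupp.single m 1) φ = 0 := by
    by_contra h
    have := hφ _ h
    rw [zero_add, wt_single] at this
    omega
  rw [this, zero_mul]

theorem Hom.pderiv_top (hφ : Hom φ (k + 1)) :
    pderiv k φ = C (constantCoeff (pderiv k φ)) := by
  ext κ
  rw [coeff_C]
  split_ifs with h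
  · subst h; rfl
  · rw [coeff_pderiv]
    have : coeff (κ + Finsupp.single k 1) φ = 0 := by
      by_contra h'
      have := hφ _ h'
      rw [map_add, wt_single] at this
      exact h (wt_eq_zero (by omega)).symm
    simp [this]

theorem Prim.const (h : Prim φ) : constantCoeff φ = 0 := by
  have := h.all (R := ZMod 2) 0 0
  rw [gstar_zero_left] at this
  have h2 : aeval (0 : ℕ → ZMod 2) φ = 0 := by linear_combination -this
  simpa using h2

open DualNumber in
theorem Prim.deriv (h : Prim φ) (hφ : Hom φ k) (m : ℕ) :
    ∑ n ∈ Finset.range k, (((n + 2).choose (m + 2) : MvPolynomial ℕ (ZMod 2)) *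
      hz (fun i => X i) (n + 1 - m)) * pderiv n φ = C (constantCoeff (pderiv m φ)) := by
  let Q := MvPolynomial ℕ (ZMod 2)
  let g : Q →ₐ[ZMod 2] DualNumber Q := TrivSqZeroExt.inlAlgHom (ZMod 2) Q Q
  have he : (ε : DualNumber Q) * ε = 0 := DualNumber.eps_mul_eps
  have h1 := h.all (fun n => g (X n)) (Pi.single m ε)
  have h2 : gstar (fun n => g (X n)) (Pi.single m ε) = fun n => g (X n) + ε *
      (((n + 2).choose (m + 2) : DualNumber Q) * hz (fun n => g (X n)) (n + 1 - m)) := by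
    ext1 n
    rw [gstar_inf _ _ _ he]
  have hx : ∀ p : Q, aeval (fun n => g (X n)) p = g p := by
    intro p
    have : (aeval (fun n => g (X n)) : Q →ₐ[ZMod 2] DualNumber Q) = g := by
      apply MvPolynomial.algHom_ext; intro i; simp
    rw [this]
  have h3 : aeval (Pi.single m (ε : DualNumber Q)) φ = ε * g (C (constantCoeff (pderiv m φ))) := by
    by_cases hm : m < k
    · have := taylor φ k hφ.vars (0 : ℕ → DualNumber Q) (Pi.single m 1) ε he
      have h4 : (fun n => (0 : ℕ → DualNumber Q) n + ε * (Pi.single m 1 : ℕ → DualNumber Q) n) =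
          Pi.single m ε := by
        ext1 n
        by_cases hn : n = m
        · subst hn; simp
        · simp [hn]
      rw [h4, Finset.sum_eq_single m] at this
      · rw [this]
        simp only [aeval_zero, h.const, Pi.single_eq_same, one_mul, map_zero, zero_add]
        congr 1
      · intro b _ hb; simp [hb]
      · simp [hm]
    · rw [hφ.pderiv_const (by omega)]
      have : aeval (Pi.single m (ε : DualNumber Q)) φ = aeval (0 : ℕ → DualNumber Q) φ := by
        refine eval₂Hom_congr' rfl ?_ rfl
        intro i hi _
        have := hφ.vars i hi
        rw [Pi.single_eq_of_ne (by omega)]; rfl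
      rw [this]
      simp [h.const]
  rw [h2, taylor φ k hφ.vars _ _ ε he, h3] at h1
  have h5 := add_left_cancel h1
  simp only [hx] at h5
  have h6 : (∑ n ∈ Finset.range k, (((n + 2).choose (m + 2) : DualNumber Q) *
      hz (fun n => g (X n)) (n + 1 - m)) * g (pderiv n φ)) =
      g (∑ n ∈ Finset.range k, (((n + 2).choose (m + 2) : MvPolynomial ℕ (ZMod 2)) *
      hz (fun i => X i) (n + 1 - m)) * pderiv n φ) := by
    rw [map_sum]
    refine Finset.sum_congr rfl fun n _ => ?_
    rw [map_mul, map_mul, map_natCast]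
    congr 2
    exact (hz_map g.toRingHom _ _).symm
  rw [h6] at h5
  have h8 : ∀ a b : Q, ε * g a = ε * g b → a = b := by
    intro a b hab
    have h7 := congrArg TrivSqZeroExt.snd hab
    simpa [g] using h7
  exact h8 _ _ h5

/-- evaluation of the derivations at `u + u ^ 2 / 2` -/
theorem Prim.rec_f (h : Prim φ) (hφ : Hom φ k) (m : ℕ) (hm : m + 1 < k) :
    aeval (Pi.single 0 (1 : ZMod 2)) (pderiv m φ) +
      (m + 3 : ZMod 2) * aeval (Pi.single 0 (1 : ZMod 2)) (pderiv (m + 1) φ) = 0 := by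
  have h1 := congrArg (aeval (Pi.single 0 (1 : ZMod 2))) (h.deriv hφ m)
  rw [hφ.pderiv_const (by omega), map_zero, map_zero, map_sum] at h1
  have h2 : ∀ n, aeval (Pi.single 0 (1 : ZMod 2))
      (((n + 2).choose (m + 2) : MvPolynomial ℕ (ZMod 2)) *
      hz (fun i => X i) (n + 1 - m) * pderiv n φ) = ((n + 2).choose (m + 2) : ZMod 2) *
      hz (Pi.single 0 1) (n + 1 - m) * aeval (Pi.single 0 (1 : ZMod 2)) (pderiv n φ) := by
    intro n
    rw [map_mul, map_mul, map_natCast]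
    congr 2
    have := hz_map (aeval (Pi.single 0 (1 : ZMod 2)) : MvPolynomial ℕ (ZMod 2) →ₐ[ZMod 2] _).toRingHom
      (fun i => X i) (n + 1 - m)
    simpa using this
  rw [Finset.sum_congr rfl (fun n _ => h2 n),
    ← Finset.sum_subset (s₁ := {m, m + 1}), Finset.sum_pair (by omega)] at h1
  · have e1 : m + 1 - m = 1 := by omega
    have e2 : m + 1 + 1 - m = 2 := by omega
    have e3 : (m + 1 + 2).choose (m + 2) = m + 3 := by
      rw [show m + 1 + 2 = (m + 2) + 1 by ring, Nat.choose_succ_self_right]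
    rw [e1, e2, e3] at h1
    simpa [hz] using h1
  · intro n hn
    simp at hn ⊢
    omega
  · intro n _ hn
    simp at hn
    by_cases hnm : n < m
    · rw [Nat.choose_eq_zero_of_lt (by omega)]; simp
    · obtain ⟨d, rfl⟩ : ∃ d, n = m + d + 2 := ⟨n - m - 2, by omega⟩
      have : m + d + 2 + 1 - m = (d + 1) + 2 := by omega
      rw [this]
      simp [hz]

open DualNumber in
theorem Prim.sum_f (h : Prim φ) (hφ : Hom φ k) (j : ℕ) (hj : j + 1 < k) :
    ∑ n ∈ Finset.range k, bell (hz (Pi.single 0 (1 : ZMod 2))) (j + 2) (n + 2) *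
      aeval (Pi.single 0 (1 : ZMod 2)) (pderiv n φ) = 0 := by
  let g : ZMod 2 →ₐ[ZMod 2] DualNumber (ZMod 2) := TrivSqZeroExt.inlAlgHom (ZMod 2) (ZMod 2) (ZMod 2)
  have he : (ε : DualNumber (ZMod 2)) * ε = 0 := DualNumber.eps_mul_eps
  let f : ℕ → ZMod 2 := Pi.single 0 1
  have h1 := h.all (Pi.single j ε) (fun n => g (f n))
  have h2 : gstar (Pi.single j ε) (fun n => g (f n)) = fun n => g (f n) + ε *
      g (bell (hz f) (j + 2) (n + 2)) := by
    ext1 n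
    have hb : ∀ l m, bell (hz fun n => g (f n)) l m = g (bell (hz f) l m) := by
      intro l m
      have := bell_map g.toRingHom (hz f) l m
      simp only [hz_map] at this
      exact this.symm
    unfold gstar hcomp
    simp only [hb]
    rw [Finset.sum_range_succ', Finset.sum_range_succ']
    have : ∀ l, hz (Pi.single j (ε : DualNumber (ZMod 2))) (l + 1 + 1) = if l = j then ε else 0 := by
      intro l; simp [hz, Pi.single_apply]
    simp only [this, ite_mul, zero_mul]
    rw [Finset.sum_ite_eq']
    have e1 : bell (hz f) (0 + 1) (n + 2) = f n := bell_one (hz f) (n + 1)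
    rw [e1]
    by_cases hjn : j < n + 1
    · simp [hz, hjn]; ring
    · rw [bell_lt _ (j + 2) _ (by omega)]
      simp [hz, hjn]
  have hx : ∀ p : MvPolynomial ℕ (ZMod 2), aeval (fun n => g (f n)) p = g (aeval f p) := by
    intro p
    have : (aeval (fun n => g (f n)) : MvPolynomial ℕ (ZMod 2) →ₐ[ZMod 2] _) = g.comp (aeval f) := by
      apply MvPolynomial.algHom_ext; intro i; simp
    rw [this]; rfl
  have h3 : aeval (Pi.single j (ε : DualNumber (ZMod 2))) φ = 0 := by
    have := taylor φ k hφ.vars (0 : ℕ → DualNumber (ZMod 2)) (Pi.single j 1) ε he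
    have h4 : (fun n => (0 : ℕ → DualNumber (ZMod 2)) n + ε * (Pi.single j 1 : ℕ → DualNumber (ZMod 2)) n) =
        Pi.single j ε := by
      ext1 n
      by_cases hn : n = j
      · subst hn; simp
      · simp [hn]
    rw [h4, Finset.sum_eq_single j] at this
    · rw [this]
      simp [h.const, hφ.pderiv_const (m := j) (by omega)]
    · intro b _ hb; simp [hb]
    · intro hb; simp at hb; omega
  rw [h2, taylor φ k hφ.vars _ _ ε he, h3] at h1
  simp only [hx, zero_add, add_eq_left] at h1
  have h6 : (∑ n ∈ Finset.range k, g (bell (hz f) (j + 2) (n + 2)) * g (aeval f (pderiv n φ))) =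
      g (∑ n ∈ Finset.range k, bell (hz f) (j + 2) (n + 2) * aeval f (pderiv n φ)) := by
    rw [map_sum]
    simp only [map_mul]
  rw [h6] at h1
  have h8 : ∀ a : ZMod 2, ε * g a = 0 → a = 0 := by
    intro a hab
    have h7 := congrArg TrivSqZeroExt.snd hab
    simpa [g] using h7
  exact h8 _ h1

/-- a primitive has no linear part -/
theorem Prim.lin (h : Prim φ) (hφ : Hom φ (k + 1)) (hk : 1 ≤ k) :
    constantCoeff (pderiv k φ) = 0 := by
  rcases Nat.lt_or_ge k 2 with hk2 | hk2
  · obtain rfl : k = 1 := by omega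
    have h1 := congrArg (coeff (Finsupp.single 0 1)) (h.deriv hφ 0)
    rw [hφ.pderiv_const (m := 0) (by omega)] at h1
    rw [Finset.sum_range_succ, Finset.sum_range_one, hφ.pderiv_top] at h1
    simp only [hz, coeff_add] at h1
    have e : (3 : MvPolynomial ℕ (ZMod 2)) = C (3 : ZMod 2) := (map_ofNat C 3).symm
    have e2 : coeff (Finsupp.single 0 1) (pderiv 0 φ) = 0 := by
      rw [coeff_pderiv]
      have : ((Finsupp.single 0 1 : ℕ →₀ ℕ) 0 + 1 : ZMod 2) = 0 := by
        simp; decide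
      rw [this, mul_zero]
    norm_num [e2] at h1
    have e3 : (3 : MvPolynomial ℕ (ZMod 2)) * X 0 * C (constantCoeff (pderiv 1 φ))
       = C (3 * constantCoeff (pderiv 1 φ)) * X 0 := by
      rw [e, C_mul]; ring
    rw [e3, coeff_C_mul, coeff_X, if_pos rfl, mul_one] at h1
    have h3 : ∀ a : ZMod 2, 3 * a = 0 → a = 0 := by decide
    exact h3 _ h1
  · set D : ℕ → ZMod 2 := fun m => aeval (Pi.single 0 (1 : ZMod 2)) (pderiv m φ) with hD
    have hr : ∀ m, m < k → D m = (m + 3 : ZMod 2) * D (m + 1) := by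
      intro m hm
      have := h.rec_f hφ m (by omega)
      have h2 : (2 : ZMod 2) = 0 := by decide
      simp only [hD]
      linear_combination this - h2 * ((m + 3 : ZMod 2) * D (m + 1))
    have hDk : D k = constantCoeff (pderiv k φ) := by
      simp only [hD]
      rw [hφ.pderiv_top]; simp
    have hD0 : ∀ d m, m + 2 + d = k → D m = 0 := by
      intro d
      induction d with
      | zero =>
        intro m hm
        rw [hr m (by omega), hr (m + 1) (by omega), ← mul_assoc]
        have : (m + 3 : ZMod 2) * ((m + 1 : ℕ) + 3 : ZMod 2) = 0 := by
          have h2 : ∀ a : ZMod 2, (a + 3) * (a + 1 + 3) = 0 := by decide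
          push_cast
          exact h2 _
        rw [this, zero_mul]
      | succ d ih =>
        intro m hm
        rw [hr m (by omega), ih (m + 1) (by omega), mul_zero]
    rw [← hDk]
    have hs : ∀ j, j + 1 < k + 1 → bell (hz (Pi.single 0 (1 : ZMod 2))) (j + 2) (k + 1) * D (k - 1) +
       bell (hz (Pi.single 0 (1 : ZMod 2))) (j + 2) (k + 2) * D k = 0 := by
      intro j hj
      have := h.sum_f hφ j hj
      obtain ⟨q, rfl⟩ : ∃ q, k = q + 1 := ⟨k - 1, by omega⟩
      rw [Finset.sum_range_succ, Finset.sum_range_succ, Finset.sum_eq_zero, zero_add] at this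
      · exact this
      · intro n hn
        simp only [Finset.mem_range] at hn
        have := hD0 (q + 1 - 2 - n) n (by omega)
        simp only [hD] at this
        rw [this, mul_zero]
    have hk1 := hr (k - 1) (by omega)
    rw [show k - 1 + 1 = k by omega] at hk1
    rcases Nat.even_or_odd' k with ⟨c, hc | hc⟩
    · have h5 := hs (c - 1) (by omega)
      have e0 : ((k - 1 : ℕ) + 3 : ZMod 2) = 0 := by
        have : ((k - 1 + 3 : ℕ) : ZMod 2) = 0 := by
          rw [ZMod.natCast_eq_zero_iff]; omega
        exact_mod_cast this
      rw [hk1, e0, show c - 1 + 2 = c + 1 by omega, show k + 2 = 2 * (c + 1) by omega,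
        bell_f_eq] at h5
      simpa using h5
    · have h5 := hs (c - 1) (by omega)
      have e0 : ((k - 1 : ℕ) + 3 : ZMod 2) = 1 := by
        have : ((k - 1 + 3 : ℕ) : ZMod 2) = (1 : ℕ) := by
          rw [ZMod.natCast_eq_natCast_iff]
          unfold Nat.ModEq; omega
        exact_mod_cast this
      rw [hk1, e0, show c - 1 + 2 = c + 1 by omega, show k + 1 = 2 * (c + 1) by omega,
        bell_f_eq, bell_f_gt _ _ (by omega)] at h5
      simpa using h5

theorem Prim.pderiv_zero (h : Prim φ) (hφ : Hom φ k) (hk : 2 ≤ k) (m : ℕ) :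
    pderiv m φ = 0 := by
  have hl : ∀ m, constantCoeff (pderiv m φ) = 0 := by
    intro m
    by_cases hm : m + 1 = k
    · subst hm
      exact h.lin hφ (by omega)
    · exact hφ.pderiv_const hm
  have hbig : ∀ m, k ≤ m → pderiv m φ = 0 := by
    intro m hm
    apply pderiv_eq_zero_of_notMem_vars
    intro hv
    have := hφ.vars m hv
    omega
  have key : ∀ d m, k ≤ m + d → pderiv m φ = 0 := by
    intro d
    induction d with
    | zero => intro m hm; exact hbig m hm
    | succ d ih =>
      intro m hm
      by_cases hmk : k ≤ m
      · exact hbig m hmk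
      · have := h.deriv hφ m
        rw [hl, map_zero, Finset.sum_eq_single m] at this
        · simpa [hz] using this
        · intro n _ hn
          by_cases hnm : n < m
          · rw [Nat.choose_eq_zero_of_lt (by omega)]; simp
          · rw [ih n (by omega), mul_zero]
        · intro hb; simp at hb; omega
  exact key k m (by omega)

theorem exists_expand (h : ∀ m, pderiv m φ = 0) : ∃ ψ, φ = expand 2 ψ := by
  have hev : ∀ κ, coeff κ φ ≠ 0 → ∃ κ', κ = 2 • κ' := by
    intro κ hκ
    have he : ∀ m, 2 ∣ κ m := by
      intro m
      by_contra hm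
      have hpos : 1 ≤ κ m := by omega
      have hle : Finsupp.single m 1 ≤ κ := by simpa using hpos
      have := congrArg (coeff (κ - Finsupp.single m 1)) (h m)
      rw [coeff_pderiv, tsub_add_cancel_of_le hle] at this
      simp only [coeff_zero, mul_eq_zero, hκ, false_or] at this
      have h2 : ((κ m : ℕ) : ZMod 2) = 0 := by
        rw [← this]
        simp only [Finsupp.coe_tsub, Pi.sub_apply, Finsupp.single_eq_same]
        rw [Nat.cast_sub hpos]; simp
      rw [ZMod.natCast_eq_zero_iff] at h2
      exact hm h2
    refine ⟨κ.mapRange (fun n => n / 2) (by simp), ?_⟩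
    ext m
    simp
    have := he m
    omega
  have : ∀ κ ∈ φ.support, ∃ ψ, monomial κ (coeff κ φ) = expand 2 ψ := by
    intro κ hκ
    obtain ⟨κ', hk⟩ := hev κ (mem_support_iff.1 hκ)
    refine ⟨monomial κ' (coeff κ φ), ?_⟩
    rw [expand_monomial, ← hk]
  choose! F hF using this
  refine ⟨∑ κ ∈ φ.support, F κ, ?_⟩
  rw [map_sum]
  conv_lhs => rw [φ.as_sum]
  exact Finset.sum_congr rfl hF

theorem Prim.eq_zero : ∀ (k : ℕ) (φ : MvPolynomial ℕ (ZMod 2)), 1 ≤ k → Prim φ → Hom φ k →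
    ((∃ i, k = 2 ^ i) → coeff (Finsupp.single 0 k) φ = 0) → φ = 0 := by
  intro k
  induction k using Nat.strong_induction_on with
  | _ k ih =>
  intro φ hk hp hφ hc
  rcases Nat.lt_or_ge k 2 with hk2 | hk2
  · obtain rfl : k = 1 := by omega
    ext κ
    rw [coeff_zero]
    by_contra hne
    have hw := hφ κ hne
    have : κ = Finsupp.single 0 1 := by
      ext i
      by_cases hi : κ i = 0
      · by_cases h0 : i = 0
        · subst h0
          exfalso
          have : κ = 0 := by
            ext j
            by_contra hj
            have := le_wt_index (i := j) hj
            obtain rfl : j = 0 := by omega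
            exact hj hi
          subst this
          simp at hw
        · simp [hi, h0]
      · have h1 := le_wt_index hi
        obtain rfl : i = 0 := by omega
        have := le_wt κ 0
        simp; omega
    rw [this] at hne
    exact hne (hc ⟨0, rfl⟩)
  · obtain ⟨ψ, rfl⟩ := exists_expand (hp.pderiv_zero hφ hk2)
    have hcoef : ∀ κ, coeff (2 • κ) (expand 2 ψ) = coeff κ ψ := fun κ =>
      coeff_expand_smul 2 (by norm_num) ψ κ
    by_cases hev : 2 ∣ k
    · obtain ⟨c, rfl⟩ := hev
      have : ψ = 0 := by
        refine ih c (by omega) ψ (by omega) ?_ ?_ ?_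
        · unfold Prim at hp ⊢
          rw [expand_zmod] at hp
          simp only [map_pow] at hp
          have hch : CharP (MvPolynomial ℕ (MvPolynomial ℕ (ZMod 2))) 2 := inferInstance
          rw [← add_pow_char] at hp
          exact frobenius_inj (MvPolynomial ℕ (MvPolynomial ℕ (ZMod 2))) 2 hp
        · intro κ hκ
          rw [← hcoef] at hκ
          have := hφ _ hκ
          rw [map_nsmul] at this
          simpa using this
        · rintro ⟨i, rfl⟩
          have := hc ⟨i + 1, by rw [pow_succ]; ring⟩
          rw [← hcoef]
          simpa using this
      rw [this, map_zero]
    · have : ψ = 0 := by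
        ext κ
        rw [coeff_zero]
        by_contra hκ
        rw [← hcoef] at hκ
        have := hφ _ hκ
        rw [map_nsmul] at this
        exact hev ⟨_, this.symm⟩
      rw [this, map_zero]

end prim

/-! ### A dual form of Nakayama's lemma over the dyadic integers -/

theorem nakayama_dual {E : Type} [AddCommGroup E] [Module ℤ_[2] E] (C : Submodule ℤ_[2] E)
    {ι : Type} [Fintype ι] [DecidableEq ι] (T : ι → E)
    (h : ∀ f : ι → ZMod 2, (∀ θ : ι → ℤ_[2], ∑ i, θ i • T i ∈ C →
      ∑ i, PadicInt.toZMod (θ i) * f i = 0) → f = 0) (i : ι) : T i ∈ C := by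
  let A : (ι → ℤ_[2]) →ₗ[ℤ_[2]] E := Fintype.linearCombination ℤ_[2] T
  have hA : ∀ θ, A θ = ∑ i, θ i • T i := fun θ => Fintype.linearCombination_apply _ _ _
  let L := C.comap A
  let red : (ι → ℤ_[2]) →+ (ι → ZMod 2) :=
    (PadicInt.toZMod (p := 2)).toAddMonoidHom.compLeft ι
  let W : Submodule (ZMod 2) (ι → ZMod 2) := AddSubgroup.toZModSubmodule 2 (L.toAddSubgroup.map red)
  have hWm : ∀ v, v ∈ W ↔ ∃ θ ∈ L, red θ = v := by
    intro v
    exact Iff.rfl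
  have hW : W = ⊤ := by
    by_contra hne
    obtain ⟨f, hf, hle⟩ := Submodule.exists_le_ker_of_lt_top W (lt_top_iff_ne_top.2 hne)
    apply hf
    have hfe : ∀ v, f v = ∑ i, v i * f (Pi.single i 1) := by
      intro v
      conv_lhs => rw [pi_eq_sum_univ' v]
      simp [map_sum]
    have := h (fun i => f (Pi.single i 1)) (by
      intro θ hθ
      have h1 : red θ ∈ W := (hWm _).2 ⟨θ, by simpa [L, hA] using hθ, rfl⟩
      have h2 := hle h1
      rw [LinearMap.mem_ker, hfe] at h2
      exact h2)
    ext v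
    simp [congrFun this v]
  have hL : (⊤ : Submodule ℤ_[2] (ι → ℤ_[2])) ≤ L := by
    refine Submodule.le_of_le_smul_of_le_jacobson_bot (I := IsLocalRing.maximalIdeal ℤ_[2])
      Module.Finite.fg_top (IsLocalRing.maximalIdeal_le_jacobson _) ?_
    intro v _
    obtain ⟨θ, hθ, hv⟩ := (hWm (red v)).1 (by rw [hW]; trivial)
    have hd : ∀ i, v i - θ i ∈ IsLocalRing.maximalIdeal ℤ_[2] := by
      intro i
      rw [← PadicInt.ker_toZMod, RingHom.mem_ker, map_sub, sub_eq_zero]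
      exact (congrFun hv i).symm
    rw [show v = θ + (v - θ) by abel]
    refine Submodule.add_mem_sup hθ ?_
    have : v - θ = ∑ i, (v i - θ i) • (Pi.single i 1 : ι → ℤ_[2]) := by
      ext j
      simp [Finset.sum_apply, Pi.single_apply]
    rw [this]
    exact Submodule.sum_mem _ fun i _ => Submodule.smul_mem_smul (hd i) trivial
  have := hL (x := Pi.single i 1) trivial
  simpa [L, A, Fintype.linearCombination_apply_single] using this

/-! ### The divided coefficients -/

theorem exists_bb (l : ℕ) : ∃ b : ℤ_[2], if l = 0 then b = 0 else
    2 * (l.factorial : ℤ_[2]) * b = 2 ^ l := by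
  by_cases h : l = 0
  · exact ⟨0, by simp [h]⟩
  simp only [h, if_false]
  obtain ⟨e, u, hu, hl⟩ := Nat.exists_eq_pow_mul_and_not_dvd (Nat.factorial_ne_zero l) 2 (by norm_num)
  have he : e < l := by
    have h1 := Nat.emultiplicity_two_factorial_lt h
    have h2 : (e : ℕ∞) ≤ emultiplicity 2 l.factorial :=
      le_emultiplicity_of_pow_dvd ⟨u, hl⟩
    exact_mod_cast h2.trans_lt h1
  have hun : IsUnit (u : ℤ_[2]) := by
    rw [PadicInt.isUnit_iff]
    have := PadicInt.norm_int_lt_one_iff_dvd (p := 2) (u : ℤ)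
    by_contra hc
    have h3 : ‖((u : ℤ) : ℤ_[2])‖ < 1 := lt_of_le_of_ne (PadicInt.norm_le_one _) (by simpa using hc)
    rw [this] at h3
    exact hu (by exact_mod_cast h3)
  obtain ⟨w, hw⟩ := hun.exists_right_inv
  refine ⟨2 ^ (l - 1 - e) * w, ?_⟩
  rw [hl]
  push_cast
  obtain ⟨d, rfl⟩ : ∃ d, l = e + d + 1 := ⟨l - e - 1, by omega⟩
  rw [show e + d + 1 - 1 - e = d by omega, pow_add, pow_add]
  linear_combination (2 * 2 ^ e * 2 ^ d) * hw

/-- The dyadic integer `2 ^ (l - 1) / l!` (and `0` for `l = 0`). -/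
noncomputable def bb (l : ℕ) : ℤ_[2] := (exists_bb l).choose

theorem bb_zero : bb 0 = 0 := by
  have := (exists_bb 0).choose_spec
  rwa [if_pos rfl] at this
theorem bb_spec {l : ℕ} (h : l ≠ 0) : 2 * (l.factorial : ℤ_[2]) * bb l = 2 ^ l := by
  have := (exists_bb l).choose_spec
  rwa [if_neg h] at this
theorem bb_one : bb 1 = 1 := by
  have := bb_spec (l := 1) (by norm_num)
  have h2 : (2 : ℤ_[2]) ≠ 0 := two_ne_zero
  apply mul_left_cancel₀ h2
  simpa using this
theorem bb_two : bb 2 = 1 := by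
  have := bb_spec (l := 2) (by norm_num)
  have h2 : (4 : ℤ_[2]) ≠ 0 := by norm_num
  apply mul_left_cancel₀ h2
  norm_num at this ⊢
  exact this

/-! ### Integrality: powers of a divided series -/

theorem pow_coeff_bell {A : Type} [CommRing A] (G : Polynomial A) (a : ℕ → A)
    (h0 : G.coeff 0 = 0)
    (h : ∀ j, 2 * ((j + 1).factorial : A) * G.coeff (j + 1) = 2 ^ (j + 1) * a (j + 1)) :
    ∀ l m, 2 ^ l * (m.factorial : A) * (G ^ l).coeff m = 2 ^ m * (l.factorial : A) * bell a l m
  | 0, 0 => by simp [bell_zero_zero]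
  | 0, m + 1 => by simp [bell_zero_succ, Polynomial.coeff_one]
  | l + 1, 0 => by
    simp [bell_succ_zero, Polynomial.coeff_zero_eq_eval_zero] at h0 ⊢
    simp [h0]
  | l + 1, m + 1 => by
    have hd : ((m : A) + 1) * (G ^ (l + 1)).coeff (m + 1) = ((l : A) + 1) *
        ∑ j ∈ Finset.range (m + 1), (G ^ l).coeff j *
          (G.coeff (m - j + 1) * ((m - j : ℕ) + 1 : A)) := by
      have h1 := Polynomial.coeff_derivative (G ^ (l + 1)) m
      rw [Polynomial.derivative_pow_succ, mul_assoc, Polynomial.coeff_C_mul, Polynomial.coeff_mul,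
        Finset.Nat.sum_antidiagonal_eq_sum_range_succ_mk] at h1
      simp only [Polynomial.coeff_derivative] at h1
      rw [mul_comm, ← h1]
    rw [bell_succ_succ, Nat.factorial_succ m, Nat.factorial_succ l]
    push_cast
    have : (2 : A) ^ (l + 1) * (((m : A) + 1) * (m.factorial : A)) * (G ^ (l + 1)).coeff (m + 1) =
        2 ^ (l + 1) * (m.factorial : A) * (((m : A) + 1) * (G ^ (l + 1)).coeff (m + 1)) := by ring
    rw [this, hd, Finset.mul_sum, Finset.mul_sum, Finset.mul_sum]
    refine Finset.sum_congr rfl fun j hj => ?_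
    simp only [Finset.mem_range] at hj
    have ih := pow_coeff_bell G a h0 h l j
    have hg := h (m - j)
    have hm : (m.factorial : A) = (m.choose j : A) * (j.factorial : A) * ((m - j).factorial : A) := by
      rw [← Nat.choose_mul_factorial_mul_factorial (show j ≤ m by omega)]
      push_cast; ring
    have hp : (2 : A) ^ (m + 1) = 2 ^ j * 2 ^ (m - j + 1) := by
      rw [← pow_add]; congr 1; omega
    rw [Nat.factorial_succ] at hg
    push_cast at hg
    rw [hm, hp]
    generalize (2 : A) ^ (m - j + 1) = q at *
    generalize ((m - j : ℕ) : A) = r at *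
    linear_combination (((l : A) + 1) * (m.choose j : A) * (2 * ((r + 1) * ((m - j).factorial : A)) * G.coeff (m - j + 1))) * ih
      + (((l : A) + 1) * (m.choose j : A) * 2 ^ j * (l.factorial : A) * bell a l j) * hg

theorem bb_pow_coeff {A : Type} [CommRing A] [IsDomain A] [CharZero A] (i : ℤ_[2] →+* A)
    (G : Polynomial A) (a : ℕ → A) (hG : ∀ j, G.coeff j = i (bb j) * a j) (l m : ℕ) :
    i (bb l) * (G ^ l).coeff m = i (bb m) * bell a l m := by
  have h0 : G.coeff 0 = 0 := by rw [hG, bb_zero]; simp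
  have hb : ∀ {l : ℕ}, l ≠ 0 → 2 * (l.factorial : A) * i (bb l) = 2 ^ l := by
    intro l hl
    have := congrArg i (bb_spec hl)
    rw [map_mul, map_mul, map_pow, map_natCast, map_ofNat i 2] at this
    exact this
  have key := pow_coeff_bell G a h0 (by
    intro j
    rw [hG, ← hb (Nat.succ_ne_zero j)]; ring) l m
  by_cases hl : l = 0
  · subst hl
    rw [bb_zero]
    match m with
    | 0 => simp [bb_zero]
    | m + 1 => simp [bell_zero_succ]
  by_cases hm : m = 0
  · subst hm
    obtain ⟨l, rfl⟩ := Nat.exists_eq_succ_of_ne_zero hl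
    rw [Nat.succ_eq_add_one, bell_succ_zero, bb_zero]
    simp [Polynomial.coeff_zero_eq_eval_zero] at h0 ⊢
    simp [h0]
  have hne : (2 * (l.factorial : A)) * (2 * (m.factorial : A)) ≠ 0 := by
    have h1 : (l.factorial : A) ≠ 0 := by exact_mod_cast Nat.factorial_ne_zero l
    have h2 : (m.factorial : A) ≠ 0 := by exact_mod_cast Nat.factorial_ne_zero m
    have h3 : (2 : A) ≠ 0 := two_ne_zero
    positivity
  apply mul_left_cancel₀ hne
  linear_combination (2 * (m.factorial : A) * (G ^ l).coeff m) * hb hl + 2 * key -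
    (2 * (l.factorial : A) * bell a l m) * hb hm


/-! ### Bihomogeneity of the composition law -/

/-- Total weight homogeneity in two sets of variables. -/
def WH {B : Type} [CommRing B] (d : ℕ) (p : MvPolynomial ℕ (MvPolynomial ℕ B)) : Prop :=
  ∀ μ ν, coeff ν (coeff μ p) ≠ 0 → wt μ + wt ν = d

section WH
variable {B : Type} [CommRing B]

theorem WH.zero (d : ℕ) : WH d (0 : MvPolynomial ℕ (MvPolynomial ℕ B)) := by
  intro μ ν h; simp at h

theorem WH.add {d : ℕ} {p q : MvPolynomial ℕ (MvPolynomial ℕ B)} (hp : WH d p) (hq : WH d q) :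
    WH d (p + q) := by
  intro μ ν h
  by_cases h1 : coeff ν (coeff μ p) = 0
  · apply hq; intro h2; apply h; simp [h1, h2]
  · exact hp _ _ h1

theorem WH.sum {d : ℕ} {ι : Type} (s : Finset ι) (p : ι → MvPolynomial ℕ (MvPolynomial ℕ B))
    (hp : ∀ i ∈ s, WH d (p i)) : WH d (∑ i ∈ s, p i) := by
  classical
  induction s using Finset.induction_on with
  | empty => simpa using WH.zero d
  | insert a s ha ih =>
    rw [Finset.sum_insert ha]
    exact (hp a (by simp)).add (ih fun i hi => hp i (by simp [hi]))

theorem WH.mul {d e : ℕ} {p q : MvPolynomial ℕ (MvPolynomial ℕ B)} (hp : WH d p) (hq : WH e q) :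
    WH (d + e) (p * q) := by
  classical
  intro μ ν h
  rw [coeff_mul, coeff_sum] at h
  obtain ⟨⟨μ1, μ2⟩, hμ, h⟩ := Finset.exists_ne_zero_of_sum_ne_zero h
  rw [coeff_mul] at h
  obtain ⟨⟨ν1, ν2⟩, hν, h⟩ := Finset.exists_ne_zero_of_sum_ne_zero h
  rw [Finset.HasAntidiagonal.mem_antidiagonal] at hμ hν
  have h1 := hp _ _ (left_ne_zero_of_mul h)
  have h2 := hq _ _ (right_ne_zero_of_mul h)
  simp only at h1 h2 hμ hν
  rw [← hμ, ← hν, map_add, map_add]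
  omega

theorem WH.const (c : B) : WH 0 (C (C c) : MvPolynomial ℕ (MvPolynomial ℕ B)) := by
  classical
  intro μ ν h
  rw [coeff_C] at h
  split_ifs at h with hμ
  · rw [coeff_C] at h
    split_ifs at h with hν
    · rw [← hμ, ← hν]; simp
    · simp at h
  · simp at h

theorem WH.one : WH 0 (1 : MvPolynomial ℕ (MvPolynomial ℕ B)) := by
  simpa using WH.const (1 : B)

theorem WH.pow {d : ℕ} {p : MvPolynomial ℕ (MvPolynomial ℕ B)} (hp : WH d p) (e : ℕ) :
    WH (e * d) (p ^ e) := by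
  induction e with
  | zero => simpa using WH.one
  | succ e ih =>
    rw [pow_succ, Nat.succ_mul]; exact ih.mul hp

theorem WH.X (m : ℕ) : WH (m + 1) (MvPolynomial.X m : MvPolynomial ℕ (MvPolynomial ℕ B)) := by
  classical
  intro μ ν h
  rw [coeff_X] at h
  split_ifs at h with hμ
  · rw [coeff_one] at h
    split_ifs at h with hν
    · rw [← hμ, ← hν, wt_single]; simp
    · simp at h
  · simp at h

theorem WH.CX (m : ℕ) : WH (m + 1) (C (MvPolynomial.X m) : MvPolynomial ℕ (MvPolynomial ℕ B)) := by
  classical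
  intro μ ν h
  rw [coeff_C] at h
  split_ifs at h with hμ
  · rw [coeff_X] at h
    split_ifs at h with hν
    · rw [← hμ, ← hν, wt_single]; simp
    · simp at h
  · simp at h

theorem WH.hz {x : ℕ → MvPolynomial ℕ (MvPolynomial ℕ B)} (hx : ∀ m, WH (m + 1) (x m)) :
    ∀ m, WH m (hz x (m + 1))
  | 0 => WH.one
  | m + 1 => hx m

theorem WH.bell {a : ℕ → MvPolynomial ℕ (MvPolynomial ℕ B)} (ha : ∀ m, WH m (a (m + 1))) :
    ∀ l m d, d + l = m → WH d (bell a l m)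
  | 0, 0, d, h => by
    obtain rfl : d = 0 := by omega
    rw [bell_zero_zero]; exact WH.one
  | 0, m + 1, d, h => by rw [bell_zero_succ]; exact WH.zero _
  | l + 1, 0, d, h => by omega
  | l + 1, m + 1, d, h => by
    rw [bell_succ_succ]
    refine WH.sum _ _ fun j hj => ?_
    simp only [Finset.mem_range] at hj
    by_cases hjl : j < l
    · rw [bell_lt _ _ _ hjl]; simpa using WH.zero d
    · have h1 := WH.bell ha l j (j - l) (by omega)
      have h2 := (WH.const (m.choose j : B)).mul h1
      have h3 := h2.mul (ha (m - j))
      rw [show 0 + (j - l) + (m - j) = d by omega] at h3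
      simpa using h3

theorem WH.gstar {x y : ℕ → MvPolynomial ℕ (MvPolynomial ℕ B)} (hx : ∀ m, WH (m + 1) (x m))
    (hy : ∀ m, WH (m + 1) (y m)) (m : ℕ) : WH (m + 1) (gstar x y m) := by
  unfold _root_.gstar hcomp
  refine WH.sum _ _ fun l hl => ?_
  simp only [Finset.mem_range] at hl
  match l with
  | 0 => simpa [_root_.hz] using WH.zero (m + 1)
  | l + 1 =>
    have := (WH.hz hx l).mul (WH.bell (WH.hz hy) (l + 1) (m + 2) (m + 1 - l) (by omega))
    rwa [show l + (m + 1 - l) = m + 1 by omega] at this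

theorem WH.prod {z : ℕ → MvPolynomial ℕ (MvPolynomial ℕ B)} (hz : ∀ m, WH (m + 1) (z m))
    (κ : ℕ →₀ ℕ) : WH (wt κ) (κ.prod fun m e => z m ^ e) := by
  induction κ using Finsupp.induction_linear with
  | zero => simpa using WH.one
  | add f g hf hg =>
    rw [Finsupp.prod_add_index' (by simp) (by intro a b c; rw [pow_add]), map_add]
    exact hf.mul hg
  | single a b =>
    rw [wt_single, Finsupp.prod_single_index (by simp)]
    exact (hz a).pow b

end WH

/-! ### The universal operation -/

section univ
variable {n : ℕ}

/-- Truncated family of variables. -/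
def trunc {A : Type} [CommRing A] (N : ℕ) (x : ℕ → A) (m : ℕ) : A := if m + 2 < N then x m else 0

theorem hz_trunc {A : Type} [CommRing A] {N : ℕ} (hN : 2 ≤ N) (x : ℕ → A) (l : ℕ) :
    hz (trunc N x) l = if l < N then hz x l else 0 := by
  match l with
  | 0 => simp [hz]
  | 1 => simp [hz, show 1 < N by omega]
  | m + 2 => simp [hz, trunc]

/-- The universal operation on `ℤ₂[ξ₁,…,ξₙ]`, truncated at `N`. -/
noncomputable def Psi (n N : ℕ) : MvPolynomial (Fin n) ℤ_[2] →ₐ[ℤ_[2]]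
    MvPolynomial ℕ (MvPolynomial (Fin n) ℤ_[2]) :=
  aeval fun i => ∑ l ∈ Finset.range N, C (C (bb l) * X i ^ l) * hz (fun m => X m) l

theorem Psi_X (N : ℕ) (i : Fin n) : Psi n N (X i) =
    ∑ l ∈ Finset.range N, C (C (bb l) * X i ^ l) * hz (fun m => X m) l := by
  simp [Psi]

theorem Psi_trunc {M N : ℕ} (hM : 2 ≤ M) (hMN : M ≤ N) (f : MvPolynomial (Fin n) ℤ_[2]) :
    aeval (trunc M fun m => (X m : MvPolynomial ℕ (MvPolynomial (Fin n) ℤ_[2]))) (Psi n N f) =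
      Psi n M f := by
  have : ((aeval (trunc M fun m => (X m : MvPolynomial ℕ (MvPolynomial (Fin n) ℤ_[2])))).restrictScalars
      ℤ_[2]).comp (Psi n N) = Psi n M := by
    apply MvPolynomial.algHom_ext
    intro i
    simp only [AlgHom.comp_apply, Psi_X, AlgHom.restrictScalars_apply, map_sum, map_mul]
    have h1 : ∀ l, aeval (trunc M fun m => (X m : MvPolynomial ℕ (MvPolynomial (Fin n) ℤ_[2])))
        (hz (fun m => (X m : MvPolynomial ℕ (MvPolynomial (Fin n) ℤ_[2]))) l) =
          if l < M then hz (fun m => X m) l else 0 := by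
      intro l
      have := hz_map (aeval (trunc M fun m => (X m : MvPolynomial ℕ (MvPolynomial (Fin n) ℤ_[2])))).toRingHom
        (fun m => (X m : MvPolynomial ℕ (MvPolynomial (Fin n) ℤ_[2]))) l
      rw [← hz_trunc hM]
      simpa using this
    simp only [h1]
    symm
    have hsub : Finset.range M ⊆ Finset.range N := by
      intro j; simp; omega
    rw [← Finset.sum_subset hsub]
    · refine Finset.sum_congr rfl fun l hl => ?_
      simp only [Finset.mem_range] at hl
      simp [hl, ← algebraMap_eq]
    · intro l _ hl
      simp only [Finset.mem_range] at hl
      simp [hl]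
  exact DFunLike.congr_fun this f

theorem coeff_trunc {S : Type} [CommRing S] (M : ℕ) (κ : ℕ →₀ ℕ) (hκ : ∀ m, κ m ≠ 0 → m + 2 < M)
    (p : MvPolynomial ℕ S) :
    coeff κ (aeval (trunc M fun m => (X m : MvPolynomial ℕ S)) p) = coeff κ p := by
  classical
  induction p using MvPolynomial.induction_on' with
  | add p q hp hq => rw [map_add, coeff_add, coeff_add, hp, hq]
  | monomial d r =>
    rw [aeval_monomial]
    by_cases hd : ∀ m ∈ d.support, m + 2 < M
    · have : (d.prod fun m e => (trunc M fun m => (X m : MvPolynomial ℕ S)) m ^ e) =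
          d.prod fun m e => (X m : MvPolynomial ℕ S) ^ e := by
        refine Finsupp.prod_congr fun m hm => ?_
        simp [trunc, hd m hm]
      rw [this, algebraMap_eq, ← monomial_eq]
    · push Not at hd
      obtain ⟨m, hm, hmM⟩ := hd
      have : (d.prod fun m e => (trunc M fun m => (X m : MvPolynomial ℕ S)) m ^ e) = 0 := by
        refine Finset.prod_eq_zero hm ?_
        have h0 : trunc M (fun m => (X m : MvPolynomial ℕ S)) m = 0 := if_neg (by omega)
        simp only [h0]
        exact zero_pow (Finsupp.mem_support_iff.1 hm)
      rw [this, mul_zero, coeff_zero, coeff_monomial, if_neg]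
      rintro rfl
      have := hκ m (Finsupp.mem_support_iff.1 hm)
      omega

/-- The operation dual to the monomial `κ`. -/
noncomputable def Tk (n : ℕ) (κ : ℕ →₀ ℕ) : Module.End ℤ_[2] (MvPolynomial (Fin n) ℤ_[2]) :=
  (LinearMap.restrictScalars ℤ_[2] (lcoeff (MvPolynomial (Fin n) ℤ_[2]) κ)).comp
    (Psi n (wt κ + 3)).toLinearMap

theorem Tk_apply' (κ : ℕ →₀ ℕ) (f : MvPolynomial (Fin n) ℤ_[2]) :
    Tk n κ f = coeff κ (Psi n (wt κ + 3) f) := rfl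

theorem coeff_Psi_eq {M N : ℕ} (hM : 2 ≤ M) (hMN : M ≤ N) (κ : ℕ →₀ ℕ)
    (hκ : ∀ m, κ m ≠ 0 → m + 2 < M) (f : MvPolynomial (Fin n) ℤ_[2]) :
    coeff κ (Psi n N f) = coeff κ (Psi n M f) := by
  rw [← Psi_trunc hM hMN, coeff_trunc M κ hκ]

theorem Tk_apply {N : ℕ} (κ : ℕ →₀ ℕ) (hN : wt κ + 3 ≤ N) (f : MvPolynomial (Fin n) ℤ_[2]) :
    Tk n κ f = coeff κ (Psi n N f) := by
  rw [Tk_apply', coeff_Psi_eq (by omega) hN]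
  intro m hm
  have := le_wt_index hm
  omega

end univ


/-! ### Composition of the operations -/

/-- The polynomial ring. -/
abbrev Sr (n : ℕ) : Type := MvPolynomial (Fin n) ℤ_[2]

/-- Polynomials in two families of variables. -/
abbrev PPr (S : Type) [CommRing S] : Type := MvPolynomial ℕ (MvPolynomial ℕ S)

section comp
variable {n : ℕ}

theorem hcomp_trunc {A : Type} [CommRing A] {N : ℕ} (hN : 2 ≤ N) (x b : ℕ → A) (m : ℕ) :
    hcomp (hz (trunc N x)) b m = ∑ l ∈ Finset.range N, hz x l * bell b l m := by
  unfold hcomp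
  refine Finset.sum_congr_of_eq_on_inter ?_ ?_ ?_
  · intro l _ hl
    rw [hz_trunc hN, if_neg (by simpa using hl), zero_mul]
  · intro l _ hl
    rw [bell_lt _ _ _ (by simp at hl; omega), mul_zero]
  · intro l _ hl
    rw [hz_trunc hN, if_pos (by simpa using hl)]

theorem comp_Psi {N : ℕ} (hN : 2 ≤ N) : ∃ N', N ≤ N' ∧ ∀ f : MvPolynomial (Fin n) ℤ_[2],
    MvPolynomial.map (Psi n N).toRingHom (Psi n N f) =
      eval₂Hom ((C : MvPolynomial ℕ (MvPolynomial (Fin n) ℤ_[2]) →+* _).comp C)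
        (gstar (trunc N fun m => (X m : MvPolynomial ℕ (MvPolynomial ℕ (MvPolynomial (Fin n) ℤ_[2]))))
          (trunc N fun m => C (X m))) (Psi n N' f) := by
  let x : ℕ → PPr (Sr n) := fun m => X m
  let y : ℕ → PPr (Sr n) := fun m => C (X m)
  refine ⟨N + N * N + 1, by omega, ?_⟩
  intro f
  let I : ℤ_[2] →+* PPr (Sr n) := (C : MvPolynomial ℕ (Sr n) →+* PPr (Sr n)).comp ((C : Sr n →+* MvPolynomial ℕ (Sr n)).comp C)
  have hPC : ∀ r : ℤ_[2], Psi n N (C r) = C (C r) := by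
    intro r
    rw [← algebraMap_eq, AlgHom.commutes]; rfl
  have : (MvPolynomial.map (Psi n N).toRingHom).comp (Psi n N).toRingHom =
      (eval₂Hom ((C : MvPolynomial ℕ (Sr n) →+* PPr (Sr n)).comp C) (gstar (trunc N x) (trunc N y))).comp
        (Psi n (N + N * N + 1)).toRingHom := by
    apply MvPolynomial.ringHom_ext
    · intro r
      have hPC' : Psi n (N + N * N + 1) (C r) = C (C r) := by
        rw [← algebraMap_eq, AlgHom.commutes]; rfl
      simp [hPC, hPC']
    · intro i
      let ξ : PPr (Sr n) := C (C (X i))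
      let G : Polynomial (PPr (Sr n)) := ∑ j ∈ Finset.range N, Polynomial.monomial j (I (bb j) * hz y j)
      have hG : ∀ j, G.coeff j = I (bb j) * hz (trunc N y) j := by
        intro j
        simp only [G, Polynomial.finsetSum_coeff, Polynomial.coeff_monomial]
        rw [Finset.sum_ite_eq', hz_trunc hN]
        simp
      have hbell := bb_pow_coeff I G (hz (trunc N y)) hG
      have hGe : (C (Psi n N (X i)) : PPr (Sr n)) = G.eval ξ := by
        simp only [G, Polynomial.eval_finsetSum, Polynomial.eval_monomial, Psi_X, map_sum, map_mul]
        refine Finset.sum_congr rfl fun j _ => ?_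
        have hm : (C (hz (fun m => (X m : MvPolynomial ℕ (Sr n))) j) : PPr (Sr n)) = hz y j := by
          rw [hz_map]
        rw [hm]
        simp only [map_pow, I, ξ, y, RingHom.comp_apply]
        ring
      have hGd : G.natDegree ≤ N := by
        refine Polynomial.natDegree_sum_le_of_forall_le _ _ fun j hj => ?_
        simp only [Finset.mem_range] at hj
        exact (Polynomial.natDegree_monomial_le _).trans hj.le
      have hL : MvPolynomial.map (Psi n N).toRingHom (Psi n N (X i)) =
          ∑ l ∈ Finset.range N, I (bb l) * (G.eval ξ) ^ l * hz x l := by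
        conv_lhs => rw [Psi_X]
        rw [map_sum]
        refine Finset.sum_congr rfl fun l _ => ?_
        have hm : MvPolynomial.map (Psi n N).toRingHom
            (hz (fun m => (X m : MvPolynomial ℕ (Sr n))) l) = hz x l := by
          match l with
          | 0 => simp [hz]
          | 1 => simp [hz]
          | l + 2 => simp [hz, x]
        rw [map_mul, map_C, hm]
        simp only [AlgHom.toRingHom_eq_coe, RingHom.coe_coe, map_mul, map_pow, hPC, hGe, map_X]
        rfl
      have hR : eval₂Hom ((C : MvPolynomial ℕ (Sr n) →+* PPr (Sr n)).comp C) (gstar (trunc N x) (trunc N y))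
          (Psi n (N + N * N + 1) (X i)) = ∑ m ∈ Finset.range (N + N * N + 1),
            I (bb m) * ξ ^ m * ∑ l ∈ Finset.range N, hz x l * bell (hz (trunc N y)) l m := by
        rw [Psi_X, map_sum]
        refine Finset.sum_congr rfl fun m _ => ?_
        have hm : eval₂Hom ((C : MvPolynomial ℕ (Sr n) →+* PPr (Sr n)).comp C)
            (gstar (trunc N x) (trunc N y)) (hz (fun m => (X m : MvPolynomial ℕ (Sr n))) m) =
              hz (gstar (trunc N x) (trunc N y)) m := by
          match m with
          | 0 => simp [hz]
          | 1 => simp [hz]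
          | l + 2 => simp [hz]
        rw [map_mul, hm, ← hcomp_trunc hN, ← hz_gstar]
        simp only [coe_eval₂Hom, eval₂_C, eval₂_X, RingHom.comp_apply, map_mul, map_pow]
        rfl
      have goal : MvPolynomial.map (Psi n N).toRingHom (Psi n N (X i)) =
        eval₂Hom ((C : MvPolynomial ℕ (Sr n) →+* PPr (Sr n)).comp C) (gstar (trunc N x) (trunc N y))
          (Psi n (N + N * N + 1) (X i)) := by
        rw [hL, hR]
        simp only [Finset.mul_sum]
        rw [Finset.sum_comm]
        refine Finset.sum_congr rfl fun l hl => ?_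
        simp only [Finset.mem_range] at hl
        have hdeg : (G ^ l).natDegree < N + N * N + 1 := by
          have h1 := Polynomial.natDegree_pow_le (p := G) (n := l)
          have h2 : l * G.natDegree ≤ N * N := Nat.mul_le_mul hl.le hGd
          omega
        rw [← Polynomial.eval_pow, Polynomial.eval_eq_sum_range' hdeg, Finset.mul_sum, Finset.sum_mul]
        refine Finset.sum_congr rfl fun m _ => ?_
        linear_combination (ξ ^ m * hz x l) * hbell l m
      exact goal
  exact RingHom.congr_fun this f

/-- Universal structure constants. -/
noncomputable def acoef (κ μ ν : ℕ →₀ ℕ) : ℤ :=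
  coeff ν (coeff μ (κ.prod fun m e =>
    gstar (fun m => (X m : MvPolynomial ℕ (MvPolynomial ℕ ℤ))) (fun m => C (X m)) m ^ e))

theorem acoef_map (B : Type) [CommRing B] (κ μ ν : ℕ →₀ ℕ) :
    coeff ν (coeff μ (κ.prod fun m e =>
      gstar (fun m => (X m : MvPolynomial ℕ (MvPolynomial ℕ B))) (fun m => C (X m)) m ^ e)) =
      (acoef κ μ ν : B) := by
  let h : MvPolynomial ℕ (MvPolynomial ℕ ℤ) →+* MvPolynomial ℕ (MvPolynomial ℕ B) :=
    MvPolynomial.map (MvPolynomial.map (Int.castRingHom B))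
  have h1 : h (κ.prod fun m e =>
    gstar (fun m => (X m : MvPolynomial ℕ (MvPolynomial ℕ ℤ))) (fun m => C (X m)) m ^ e) =
      κ.prod fun m e =>
      gstar (fun m => (X m : MvPolynomial ℕ (MvPolynomial ℕ B))) (fun m => C (X m)) m ^ e := by
    rw [Finsupp.prod, map_prod]
    refine Finset.prod_congr rfl fun m _ => ?_
    rw [map_pow, gstar_map]
    simp [h]
  rw [← h1]
  simp only [h, coeff_map, acoef]
  simp

theorem Tk_mul (k : ℕ) (μ ν : ℕ →₀ ℕ) (hk : wt μ + wt ν = k) :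
    Tk n ν * Tk n μ = ∑ κ ∈ (wt_finite k).toFinset, ((acoef κ μ ν : ℤ) : ℤ_[2]) • Tk n κ := by
  let x : ℕ → PPr (Sr n) := fun m => X m
  let y : ℕ → PPr (Sr n) := fun m => C (X m)
  obtain ⟨N', hN', hc⟩ := comp_Psi (n := n) (N := k + 3) (by omega)
  apply LinearMap.ext
  intro f
  have hL : (Tk n ν * Tk n μ) f = coeff ν (coeff μ (MvPolynomial.map (Psi n (k + 3)).toRingHom
      (Psi n (k + 3) f))) := by
    rw [coeff_map, Module.End.mul_apply, Tk_apply (N := k + 3) μ (by omega),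
      Tk_apply (N := k + 3) ν (by omega)]
    rfl
  rw [hL, hc, coe_eval₂Hom, eval₂_eq, coeff_sum, coeff_sum, LinearMap.sum_apply]
  have hterm : ∀ κ : ℕ →₀ ℕ, coeff ν (coeff μ (((C : MvPolynomial ℕ (Sr n) →+* PPr (Sr n)).comp C)
      (coeff κ (Psi n N' f)) * ∏ i ∈ κ.support, gstar (trunc (k + 3) x) (trunc (k + 3) y) i ^ κ i)) =
      coeff κ (Psi n N' f) * coeff ν (coeff μ (κ.prod fun m e =>
        gstar (trunc (k + 3) x) (trunc (k + 3) y) m ^ e)) := by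
    intro κ
    rw [RingHom.comp_apply, coeff_C_mul, coeff_C_mul]
    rfl
  have hWH : ∀ κ : ℕ →₀ ℕ, WH (wt κ) (κ.prod fun m e =>
        gstar (trunc (k + 3) x) (trunc (k + 3) y) m ^ e) := by
    intro κ
    refine WH.prod (WH.gstar ?_ ?_) κ
    · intro m
      unfold trunc
      split_ifs
      · exact WH.X m
      · exact WH.zero _
    · intro m
      unfold trunc
      split_ifs
      · exact WH.CX m
      · exact WH.zero _
  refine Finset.sum_congr_of_eq_on_inter ?_ ?_ ?_
  · intro κ _ hκ
    refine (hterm κ).trans ?_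
    have : coeff ν (coeff μ (κ.prod fun m e =>
        gstar (trunc (k + 3) x) (trunc (k + 3) y) m ^ e)) = 0 := by
      by_contra hne
      have := hWH κ μ ν hne
      apply hκ
      simp; omega
    rw [this, mul_zero]
  · intro κ hκ hs
    have hw : wt κ = k := by simpa using hκ
    rw [LinearMap.smul_apply, Tk_apply (N := N') κ (by omega), notMem_support_iff.1 hs, smul_zero]
  · intro κ _ hκ
    have hw : wt κ = k := by simpa using hκ
    refine (hterm κ).trans ?_
    have he : (κ.prod fun m e => gstar (trunc (k + 3) x) (trunc (k + 3) y) m ^ e) =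
        κ.prod fun m e => gstar x y m ^ e := by
      refine Finsupp.prod_congr fun m hm => ?_
      have := le_wt_index (Finsupp.mem_support_iff.1 hm)
      rw [gstar_congr (x' := x) (y' := y)]
      · intro i hi; exact if_pos (by omega)
      · intro i hi; exact if_pos (by omega)
    rw [he, LinearMap.smul_apply, Tk_apply (N := N') κ (by omega)]
    have ha := acoef_map (Sr n) κ μ ν
    refine (congrArg _ ha).trans ?_
    rw [MvPolynomial.smul_eq_C_mul, mul_comm, map_intCast]

end comp

/-! ### Identification of the dyadic squares -/

section ident
variable {n : ℕ}

theorem coeff_aeval_X_zero {S : Type} [CommRing S] (k : ℕ) (q : Polynomial S) :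
    coeff (Finsupp.single 0 k) (Polynomial.aeval (X 0 : MvPolynomial ℕ S) q) = q.coeff k := by
  classical
  induction q using Polynomial.induction_on' with
  | add p q hp hq => rw [map_add, coeff_add, Polynomial.coeff_add, hp, hq]
  | monomial j a =>
    rw [Polynomial.aeval_monomial, algebraMap_eq, coeff_C_mul, coeff_X_pow, Polynomial.coeff_monomial]
    by_cases h : j = k
    · simp [h]
    · have : ¬ (Finsupp.single 0 j = (Finsupp.single 0 k : ℕ →₀ ℕ)) := by
        intro h'; exact h (by simpa using DFunLike.congr_fun h' 0)
      simp [h, this]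

theorem Psi_three (f : MvPolynomial (Fin n) ℤ_[2]) :
    Polynomial.aeval (X 0 : MvPolynomial ℕ (MvPolynomial (Fin n) ℤ_[2])) (JqT ℤ_[2] n f) =
      Psi n 3 f := by
  have : ((Polynomial.aeval (X 0 : MvPolynomial ℕ (MvPolynomial (Fin n) ℤ_[2]))).restrictScalars
      ℤ_[2]).comp (JqT ℤ_[2] n) = Psi n 3 := by
    apply MvPolynomial.algHom_ext
    intro i
    rw [Psi_X]
    simp [JqT, Finset.sum_range_succ, bb_zero, bb_one, bb_two, hz, algebraMap_eq]
  exact DFunLike.congr_fun this f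

theorem Jq_eq_Tk (k : ℕ) : Jq ℤ_[2] n k = Tk n (Finsupp.single 0 k) := by
  apply LinearMap.ext
  intro f
  have h1 : Jq ℤ_[2] n k f = (JqT ℤ_[2] n f).coeff k := rfl
  rw [h1, Tk_apply', coeff_Psi_eq (M := 3) (by omega) (by omega), ← Psi_three, coeff_aeval_X_zero]
  intro m hm
  by_cases h0 : m = 0
  · omega
  · simp [h0] at hm

theorem Tk_zero : Tk n 0 = 1 := by
  apply LinearMap.ext
  intro f
  rw [Tk_apply']
  have : ((constantCoeff : MvPolynomial ℕ (MvPolynomial (Fin n) ℤ_[2]) →+* _)).comp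
      (Psi n 3).toRingHom = RingHom.id _ := by
    apply MvPolynomial.ringHom_ext
    · intro r
      have : Psi n 3 (C r) = C (C r) := by
        rw [← algebraMap_eq, AlgHom.commutes]; rfl
      simp [this]
    · intro i
      simp [Psi_X, Finset.sum_range_succ, bb_zero, bb_one, bb_two, hz]
  simpa [constantCoeff_eq] using RingHom.congr_fun this f

end ident


/-! ### Main argument -/

/-- A homogeneous dual functional annihilating all products is primitive. -/
theorem prim_of_annihilates {k : ℕ} (hk : 1 ≤ k) {φ : MvPolynomial ℕ (ZMod 2)} (hφ : Hom φ k)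
    (h : ∀ μ ν : ℕ →₀ ℕ, μ ≠ 0 → ν ≠ 0 → wt μ + wt ν = k →
      ∑ κ ∈ (wt_finite k).toFinset, (acoef κ μ ν : ZMod 2) * coeff κ φ = 0) : Prim φ := by
  classical
  let x : ℕ → PPr (ZMod 2) := fun m => X m
  let y : ℕ → PPr (ZMod 2) := fun m => C (X m)
  have h0 : coeff 0 φ = 0 := by
    by_contra hne
    have := hφ 0 hne
    simp at this; omega
  have hx : aeval x φ = MvPolynomial.map C φ := by
    have : (aeval x : MvPolynomial ℕ (ZMod 2) →ₐ[ZMod 2] PPr (ZMod 2)).toRingHom = MvPolynomial.map C := by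
      apply MvPolynomial.ringHom_ext
      · intro r; simp
      · intro i; simp [x]
    exact RingHom.congr_fun this φ
  have hy : aeval y φ = C φ := by
    have : (aeval y : MvPolynomial ℕ (ZMod 2) →ₐ[ZMod 2] PPr (ZMod 2)).toRingHom = C := by
      apply MvPolynomial.ringHom_ext
      · intro r; simp
      · intro i; simp [y]
    exact RingHom.congr_fun this φ
  have hL : ∀ μ ν, coeff ν (coeff μ (aeval (gstar x y) φ)) =
      ∑ κ ∈ (wt_finite k).toFinset, (acoef κ μ ν : ZMod 2) * coeff κ φ := by
    intro μ ν
    rw [aeval_def, eval₂_eq, coeff_sum, coeff_sum]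
    have hterm : ∀ κ : ℕ →₀ ℕ, coeff ν (coeff μ (algebraMap (ZMod 2) (PPr (ZMod 2)) (coeff κ φ) *
        ∏ i ∈ κ.support, gstar x y i ^ κ i)) = (acoef κ μ ν : ZMod 2) * coeff κ φ := by
      intro κ
      rw [show algebraMap (ZMod 2) (PPr (ZMod 2)) (coeff κ φ) = C (C (coeff κ φ)) from rfl, coeff_C_mul,
        coeff_C_mul, mul_comm]
      exact congrArg (· * coeff κ φ) (acoef_map (ZMod 2) κ μ ν)
    rw [Finset.sum_congr rfl fun κ _ => hterm κ]
    refine Finset.sum_subset ?_ ?_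
    · intro κ hκ
      simpa using hφ κ (mem_support_iff.1 hκ)
    · intro κ _ hκ
      rw [notMem_support_iff.1 hκ, mul_zero]
  have e1 : ∀ ν, coeff ν (coeff 0 (aeval (gstar x y) φ)) = coeff ν φ := by
    intro ν
    have : ((constantCoeff : PPr (ZMod 2) →+* _)).comp
        (aeval (gstar x y) : MvPolynomial ℕ (ZMod 2) →ₐ[ZMod 2] PPr (ZMod 2)).toRingHom = RingHom.id _ := by
      apply MvPolynomial.ringHom_ext
      · intro r; simp
      · intro i
        have h1 := gstar_map (constantCoeff : PPr (ZMod 2) →+* _) x y i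
        simp only [x, y, constantCoeff_X, constantCoeff_C] at h1
        have h2 := congrFun (gstar_zero_left (fun m => (X m : MvPolynomial ℕ (ZMod 2)))) i
        simp [x, y]
        rw [h1]; exact h2
    exact congrArg (coeff ν) (RingHom.congr_fun this φ)
  have e2 : ∀ μ, coeff 0 (coeff μ (aeval (gstar x y) φ)) = coeff μ φ := by
    intro μ
    have : (MvPolynomial.map (constantCoeff : MvPolynomial ℕ (ZMod 2) →+* _)).comp
        (aeval (gstar x y) : MvPolynomial ℕ (ZMod 2) →ₐ[ZMod 2] PPr (ZMod 2)).toRingHom = RingHom.id _ := by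
      apply MvPolynomial.ringHom_ext
      · intro r
        have : algebraMap (ZMod 2) (PPr (ZMod 2)) r = C (C r) := rfl
        simp [this]
      · intro i
        have h1 := gstar_map (MvPolynomial.map (constantCoeff : MvPolynomial ℕ (ZMod 2) →+* _)) x y i
        simp only [x, y, map_X, map_C, constantCoeff_X, map_zero] at h1
        have h2 := congrFun (gstar_zero_right (fun m => (X m : MvPolynomial ℕ (ZMod 2)))) i
        simp [x, y]
        rw [h1]; exact h2
    have := congrArg (coeff μ) (RingHom.congr_fun this φ)
    rw [RingHom.comp_apply, coeff_map] at this
    exact this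
  have key : aeval (gstar x y) φ = aeval x φ + aeval y φ := by
    refine MvPolynomial.ext _ _ fun μ => MvPolynomial.ext _ _ fun ν => ?_
    rw [coeff_add, coeff_add, hx, hy, coeff_map, coeff_C, coeff_C]
    by_cases hμ : μ = 0
    · subst hμ
      rw [e1, h0]; simp
    by_cases hν : ν = 0
    · subst hν
      rw [e2, if_neg (Ne.symm hμ)]; simp
    rw [if_neg (Ne.symm hμ), if_neg (Ne.symm hν), hL]
    by_cases hw : wt μ + wt ν = k
    · rw [h μ ν hμ hν hw]; simp
    · rw [Finset.sum_eq_zero]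
      · simp
      · intro κ hκ
        have hκ' : wt κ = k := by simpa using hκ
        rw [← acoef_map (ZMod 2) κ μ ν]
        have hWH : WH (wt κ) (κ.prod fun m e => gstar x y m ^ e) :=
          WH.prod (WH.gstar WH.X WH.CX) κ
        have : coeff ν (coeff μ (κ.prod fun m e => gstar x y m ^ e)) = 0 := by
          by_contra hne
          have := hWH μ ν hne
          omega
        exact (congrArg (· * coeff κ φ) this).trans (zero_mul _)
  exact key

theorem Tk_mem (n : ℕ) : ∀ (k : ℕ) (κ : ℕ →₀ ℕ), wt κ = k → Tk n κ ∈
      Algebra.adjoin ℤ_[2]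
        (Set.range fun i : ℕ =>
          (Jq ℤ_[2] n (2 ^ i) : Module.End ℤ_[2] (MvPolynomial (Fin n) ℤ_[2]))) := by
  classical
  intro k
  induction k using Nat.strong_induction_on with
  | _ k ih =>
  intro κ₀ hκ₀
  set A := Algebra.adjoin ℤ_[2]
        (Set.range fun i : ℕ =>
          (Jq ℤ_[2] n (2 ^ i) : Module.End ℤ_[2] (MvPolynomial (Fin n) ℤ_[2]))) with hA
  by_cases hk : k = 0
  · rw [wt_eq_zero (hκ₀.trans hk), Tk_zero]
    exact one_mem _
  let ι := {κ // κ ∈ (wt_finite k).toFinset}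
  have main := nakayama_dual (Subalgebra.toSubmodule A) (ι := ι) (fun κ => Tk n κ.1) ?_
    ⟨κ₀, by simpa using hκ₀⟩
  · exact main
  intro f hf
  let φ : MvPolynomial ℕ (ZMod 2) := ∑ κ : ι, monomial κ.1 (f κ)
  have hcoef : ∀ κ : ι, coeff κ.1 φ = f κ := by
    intro κ
    simp only [φ, coeff_sum, coeff_monomial]
    rw [Finset.sum_eq_single κ]
    · simp
    · intro b _ hb
      rw [if_neg]
      intro h; exact hb (Subtype.ext h)
    · simp
  have hφ : Hom φ k := by
    intro κ hne
    simp only [φ, coeff_sum, coeff_monomial] at hne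
    obtain ⟨b, _, hb⟩ := Finset.exists_ne_zero_of_sum_ne_zero hne
    have hbk : b.1 = κ := by
      by_contra h; rw [if_neg h] at hb; exact hb rfl
    have hb2 : b.1 ∈ (wt_finite k).toFinset := b.2
    rw [hbk] at hb2
    simpa using hb2
  have hprim : Prim φ := by
    refine prim_of_annihilates (by omega) hφ fun μ ν hμ hν hw => ?_
    have hμ' : wt μ ≠ 0 := fun h => hμ (wt_eq_zero h)
    have hν' : wt ν ≠ 0 := fun h => hν (wt_eq_zero h)
    have hmem : Tk n ν * Tk n μ ∈ A :=
      mul_mem (ih _ (by omega) ν rfl) (ih _ (by omega) μ rfl)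
    rw [Tk_mul k μ ν hw, ← Finset.sum_coe_sort] at hmem
    have := hf (fun κ => ((acoef κ.1 μ ν : ℤ) : ℤ_[2])) hmem
    rw [← Finset.sum_coe_sort]
    rw [← this]
    refine Finset.sum_congr rfl fun κ _ => ?_
    rw [map_intCast]
    exact congrArg _ (hcoef κ)
  have hzero : φ = 0 := by
    refine Prim.eq_zero k φ (by omega) hprim hφ ?_
    rintro ⟨i, hi⟩
    have hw : Finsupp.single 0 k ∈ (wt_finite k).toFinset := by simp [wt_single]
    let κ₁ : ι := ⟨Finsupp.single 0 k, hw⟩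
    have hmem : Tk n (Finsupp.single 0 k) ∈ A := by
      rw [← Jq_eq_Tk, hi]
      exact Algebra.subset_adjoin ⟨i, rfl⟩
    have := hf (Pi.single κ₁ 1) (by
      rw [Finset.sum_eq_single κ₁]
      · simpa [κ₁] using hmem
      · intro b _ hb; simp [hb]
      · simp)
    rw [Finset.sum_eq_single κ₁] at this
    · rw [← hcoef κ₁] at this
      simpa [κ₁] using this
    · intro b _ hb; simp [hb]
    · simp
  ext κ
  rw [← hcoef κ, hzero]; simp

/-- The `ℤ₂`-algebra generated by the `Jq^k` is generated by `{Jq^{2^i}}_{i ≥ 0}`: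
every `Jq^k` lies in the `ℤ₂`-subalgebra of `End(ℤ₂[ξ₁,…,ξₙ])` generated by the
operators `Jq^{2^i}`, `i ≥ 0`. -/
theorem jq_mem_adjoin_jq_two_pow (n : ℕ) (hn : 1 ≤ n) (k : ℕ) :
    (Jq ℤ_[2] n k : Module.End ℤ_[2] (MvPolynomial (Fin n) ℤ_[2])) ∈
      Algebra.adjoin ℤ_[2]
        (Set.range fun i : ℕ =>
          (Jq ℤ_[2] n (2 ^ i) : Module.End ℤ_[2] (MvPolynomial (Fin n) ℤ_[2]))) := by
  exact (Jq_eq_Tk (n := n) k).symm ▸ Tk_mem n k (Finsupp.single 0 k) (by rw [wt_single]; simp)
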